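/- For every ε > 0 there exists a constant C(ε) > 0 depending only on ε such that for all positive integers Q and N, M(Q,N) ≤ C(ε) · ( Q³/N + (√Q + Q²/√N) · N^ε ), where M(Q,N) = max over x ∈ S_Q of the number of x' ∈ S_Q with ‖x − x'‖ < 1/(2N). -/

import Mathlib

open Finset Real
open scoped Classical

noncomputable def e (x : ℝ) : ℂ := Complex.exp (2 * Real.pi * Complex.I * x)

noncomputable def dist01 (x : ℝ) : ℝ := |x - round x|

noncomputable def SQ (Q : ℕ) : Finset ℚ :=
  (Finset.Ioc Q (2*Q)).biUnion fun q =>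
    ((Finset.Ico 1 (q^2)).filter fun a => Nat.gcd a q = 1).image fun a => (a : ℚ) / (q : ℚ)^2

noncomputable def MQN (Q N : ℕ) : ℕ :=
  (SQ Q).sup fun x => ((SQ Q).filter fun x' => dist01 ((x : ℝ) - (x' : ℝ)) < 1/(2*N)).card

lemma divisor_bound (ε : ℝ) (hε : 0 < ε) : ∃ C : ℝ, 1 ≤ C ∧ ∀ n : ℕ, n ≠ 0 →
    (n.divisors.card : ℝ) ≤ C * (n:ℝ)^ε := by
  have hl : 0 < Real.log 2 := Real.log_pos (by norm_num)
  set K : ℝ := 1 + 1 / (ε * Real.log 2) with hK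
  have hK0 : 0 < 1 / (ε * Real.log 2) := by positivity
  have hK1 : 1 ≤ K := by linarith
  set P : ℕ := ⌈(2:ℝ)^(1/ε)⌉₊ with hP
  refine ⟨K ^ P, one_le_pow₀ hK1, fun n hn => ?_⟩
  have key : ∀ p ∈ n.primeFactors, ((n.factorization p + 1 : ℕ) : ℝ) ≤
      (if p < P then K else 1) * (((p ^ n.factorization p : ℕ) : ℝ)) ^ ε := by
    intro p hp
    have hpp := Nat.prime_of_mem_primeFactors hp
    have hp2 : (2:ℝ) ≤ p := by exact_mod_cast hpp.two_le
    set k := n.factorization p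
    have e1 : (((p ^ k : ℕ) : ℝ)) ^ ε = ((p:ℝ)^ε)^k := by
      push_cast
      rw [← Real.rpow_natCast, ← Real.rpow_natCast, ← Real.rpow_mul (by positivity),
        ← Real.rpow_mul (by positivity), mul_comm]
    rw [e1]
    split_ifs with h
    · have h2 : 1 + ε * Real.log 2 ≤ (p:ℝ)^ε := by
        calc 1 + ε * Real.log 2 ≤ Real.exp (ε * Real.log 2) := by
              linarith [Real.add_one_le_exp (ε * Real.log 2)]
          _ = (2:ℝ)^ε := by rw [Real.rpow_def_of_pos (by norm_num), mul_comm]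
          _ ≤ _ := Real.rpow_le_rpow (by norm_num) hp2 hε.le
      have h3 : 1 + (k:ℝ) * (ε * Real.log 2) ≤ ((p:ℝ)^ε)^k := by
        refine le_trans (one_add_mul_le_pow (a := ε * Real.log 2) ?_ k) ?_
        · have : 0 < ε * Real.log 2 := by positivity
          linarith
        · exact pow_le_pow_left₀ (by positivity) h2 k
      have h4 : (k:ℝ) + 1 ≤ K * (1 + (k:ℝ) * (ε * Real.log 2)) := by
        have : K * (1 + (k:ℝ) * (ε * Real.log 2)) =
          1 + k + (k:ℝ) * (ε * Real.log 2) + 1 / (ε * Real.log 2) := by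
          rw [hK]; field_simp; ring
        rw [this]
        have : 0 ≤ (k:ℝ) * (ε * Real.log 2) := by positivity
        linarith
      push_cast
      exact h4.trans (mul_le_mul_of_nonneg_left h3 (by linarith))
    · have h2 : (2:ℝ) ≤ (p:ℝ)^ε := by
        have h5 : (2:ℝ)^(1/ε) ≤ p := by
          refine (Nat.le_ceil _).trans ?_
          exact_mod_cast not_lt.mp h
        calc (2:ℝ) = ((2:ℝ)^(1/ε))^ε := by
              rw [← Real.rpow_mul (by norm_num)]
              field_simp
              simp
          _ ≤ _ := Real.rpow_le_rpow (by positivity) h5 hε.le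
      have h3 : ((k + 1 : ℕ) : ℝ) ≤ (2:ℝ)^k := by
        exact_mod_cast Nat.lt_two_pow_self
      rw [one_mul]
      exact h3.trans (pow_le_pow_left₀ (by norm_num) h2 k)
  rw [Nat.card_divisors hn]
  have hprod : (n:ℝ)^ε = ∏ p ∈ n.primeFactors, (((p ^ n.factorization p : ℕ) : ℝ)) ^ ε := by
    rw [Real.finsetProd_rpow _ _ (fun i _ => by positivity), ← Nat.cast_prod]
    congr 2
    exact (Nat.prod_factorization_pow_eq_self hn).symm
  rw [hprod, Nat.cast_prod]
  refine (Finset.prod_le_prod (fun _ _ => by positivity) key).trans ?_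
  rw [Finset.prod_mul_distrib]
  refine mul_le_mul_of_nonneg_right ?_ (Finset.prod_nonneg fun _ _ => by positivity)
  rw [Finset.prod_ite, Finset.prod_const, Finset.prod_const_one, mul_one]
  refine pow_le_pow_right₀ hK1 ?_
  calc _ ≤ (Finset.range P).card := Finset.card_le_card (by
          intro p hp; simp at hp ⊢; exact hp.2)
    _ = P := by simp

lemma card_int_le (S : Finset ℤ) (y h : ℝ) (hh : 0 ≤ h) (H : ∀ a ∈ S, |(a:ℝ) - y| ≤ h) :
    (S.card : ℝ) ≤ 2 * h + 1 := by
  have hsub : S ⊆ Finset.Icc ⌈y - h⌉ ⌊y + h⌋ := by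
    intro a ha
    have := abs_le.mp (H a ha)
    rw [Finset.mem_Icc]
    exact ⟨Int.ceil_le.mpr (by linarith), Int.le_floor.mpr (by linarith)⟩
  have h1 := Finset.card_le_card hsub
  rw [Int.card_Icc] at h1
  have h2 : (S.card : ℝ) ≤ (((⌊y+h⌋ + 1 - ⌈y-h⌉).toNat : ℕ) : ℝ) := by exact_mod_cast h1
  refine h2.trans ?_
  rcases le_total 0 (⌊y+h⌋ + 1 - ⌈y-h⌉) with h0 | h0
  · have : (((⌊y+h⌋ + 1 - ⌈y-h⌉).toNat : ℕ) : ℝ) = ((⌊y+h⌋ + 1 - ⌈y-h⌉ : ℤ) : ℝ) := by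
      exact_mod_cast congrArg (Int.cast (R := ℝ)) (Int.toNat_of_nonneg h0)
    rw [this]
    push_cast
    linarith [Int.floor_le (y+h), Int.le_ceil (y-h)]
  · rw [Int.toNat_of_nonpos h0]
    push_cast
    linarith

/-- Count of `m` with `b m / R` near an integer. -/
lemma count_B (b R M : ℤ) (hR : 0 < R) (hb : IsCoprime b R) (hM : M < 4 * R) (δ : ℝ) (hδ : 0 ≤ δ)
    (S : Finset ℤ) (hS : ∀ m ∈ S, |m| ≤ M)
    (hc : ∀ m ∈ S, ∃ c : ℤ, |(b:ℝ) / R * m - c| ≤ δ) :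
    (S.card : ℝ) ≤ 9 * (2 * (δ * R) + 1) := by
  choose! c hc using hc
  have hR' : (0:ℝ) < R := by exact_mod_cast hR
  set t : ℤ → ℤ := fun m => b * m - c m * R with ht
  have hcard : S.card ≤ ((S.image t) ×ˢ (Finset.Icc (-4:ℤ) 4)).card := by
    refine Finset.card_le_card_of_injOn (fun m => (t m, m / R)) ?_ ?_
    · intro m hm
      have h1 := abs_le.mp (hS m hm)
      simp only [Finset.coe_product, Set.mem_prod, Finset.mem_coe]
      refine ⟨Finset.mem_image_of_mem _ hm, Finset.mem_Icc.mpr ⟨?_, ?_⟩⟩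
      · exact (Int.le_ediv_iff_mul_le hR).mpr (by linarith)
      · have : m / R < 4 := (Int.ediv_lt_iff_lt_mul hR).mpr (by linarith)
        exact this.le
    · intro m hm m' hm' h
      simp only [Prod.mk.injEq, ht] at h
      obtain ⟨h1, h2⟩ := h
      have hd : R ∣ (m - m') := by
        refine hb.symm.dvd_of_dvd_mul_left (z := m - m') ?_
        exact ⟨c m - c m', by linarith⟩
      have h3 : m % R = m' % R := 
        Int.emod_eq_emod_iff_emod_sub_eq_zero.mpr (Int.emod_eq_zero_of_dvd hd)
      rw [← Int.mul_ediv_add_emod m R, ← Int.mul_ediv_add_emod m' R, h2, h3]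
  rw [Finset.card_product] at hcard
  have h9 : (Finset.Icc (-4:ℤ) 4).card = 9 := by decide
  rw [h9] at hcard
  have ht2 : ((S.image t).card : ℝ) ≤ 2 * (δ * R) + 1 := by
    refine card_int_le _ 0 _ (by positivity) ?_
    intro a ha
    obtain ⟨m, hm, rfl⟩ := Finset.mem_image.mp ha
    have h1 := hc m hm
    have : ((t m : ℤ) : ℝ) - 0 = ((b:ℝ) / R * m - c m) * R := by
      simp only [ht]; push_cast; field_simp; ring
    rw [this, abs_mul, abs_of_pos hR']
    exact mul_le_mul_of_nonneg_right h1 hR'.le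
  have : (S.card : ℝ) ≤ ((S.image t).card : ℝ) * 9 := by exact_mod_cast hcard
  linarith

lemma count_A (Q : ℕ) (hQ : 0 < Q) (b R : ℤ) (hR : (Q:ℤ)^2 < R) (hb : IsCoprime b R)
    (δ : ℝ) (hδ : 0 ≤ δ) (D : ℝ)
    (hD : ∀ n : ℕ, n ≠ 0 → n ≤ 4 * Q^2 → (n.divisors.card : ℝ) ≤ D)
    (A : Finset ℕ) (hA : A ⊆ Finset.Ioc Q (2*Q))
    (hc : ∀ q ∈ A, ∃ c : ℤ, |(b:ℝ) / R * (q:ℝ)^2 - c| ≤ δ) :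
    (A.card : ℝ)^2 ≤ A.card + D * (9 * (2 * (2 * δ * R) + 1)) := by
  set f : ℕ × ℕ → ℤ := fun p => (p.1:ℤ)^2 - (p.2:ℤ)^2 with hf
  set B := A.offDiag.image f with hB
  have hrange : ∀ q ∈ A, Q < q ∧ q ≤ 2 * Q := fun q hq => Finset.mem_Ioc.mp (hA hq)
  have hBm : ∀ m ∈ B, |m| ≤ 4 * (Q:ℤ)^2 := by
    intro m hm
    obtain ⟨⟨p, q⟩, hpq, rfl⟩ := Finset.mem_image.mp hm
    obtain ⟨h1, h2, h3⟩ := Finset.mem_offDiag.mp hpq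
    have h1 := hrange _ h1
    have h2 := hrange _ h2
    simp only [hf] at *
    zify at h1 h2
    rw [abs_le]
    constructor <;> nlinarith
  have hB0 : ∀ m ∈ B, m ≠ 0 := by
    intro m hm
    obtain ⟨⟨p, q⟩, hpq, rfl⟩ := Finset.mem_image.mp hm
    obtain ⟨h1, h2, h3⟩ := Finset.mem_offDiag.mp hpq
    simp only [hf] at *
    intro h
    apply h3
    have : (p:ℤ)^2 = (q:ℤ)^2 := by linarith
    have : p^2 = q^2 := by exact_mod_cast this
    exact Nat.pow_left_injective (by norm_num : 2 ≠ 0) this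
  have hBc : (B.card : ℝ) ≤ 9 * (2 * (2 * δ * R) + 1) := by
    refine count_B b R (4 * (Q:ℤ)^2) (by nlinarith [sq_nonneg (Q:ℤ)]) hb (by linarith) (2 * δ) (by positivity) B hBm ?_
    intro m hm
    obtain ⟨⟨p, q⟩, hpq, rfl⟩ := Finset.mem_image.mp hm
    obtain ⟨h1, h2, h3⟩ := Finset.mem_offDiag.mp hpq
    obtain ⟨c1, h1⟩ := hc _ h1
    obtain ⟨c2, h2⟩ := hc _ h2
    refine ⟨c1 - c2, ?_⟩
    simp only [hf]
    rw [abs_le] at *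
    push_cast
    constructor <;> linarith
  have hfib : ∀ m ∈ B, ((A.offDiag.filter fun p => f p = m).card : ℝ) ≤ D := by
    intro m hm
    have hm0 := hB0 m hm
    refine le_trans ?_ (hD m.natAbs (by simpa using hm0) (by
      have := hBm m hm
      zify; exact this))
    have : (A.offDiag.filter fun p => f p = m).card ≤ m.natAbs.divisors.card := by
      refine Finset.card_le_card_of_injOn (fun p => ((p.1:ℤ) - p.2).natAbs) ?_ ?_
      · rintro ⟨p, q⟩ hp
        obtain ⟨h1, h2⟩ := Finset.mem_filter.mp hp
        simp only [hf] at h2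
        simp only [Finset.mem_coe, Nat.mem_divisors]
        refine ⟨?_, by simpa using hm0⟩
        rw [Int.natAbs_dvd_natAbs]
        exact ⟨p + q, by rw [← h2]; ring⟩
      · rintro ⟨p, q⟩ hp ⟨p', q'⟩ hp' h
        obtain ⟨h1, h2⟩ := Finset.mem_filter.mp hp
        obtain ⟨h1', h2'⟩ := Finset.mem_filter.mp hp'
        obtain ⟨ha, hb', -⟩ := Finset.mem_offDiag.mp h1
        obtain ⟨ha', hb'', -⟩ := Finset.mem_offDiag.mp h1'
        have ha := hrange _ ha
        have hb' := hrange _ hb'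
        have ha' := hrange _ ha'
        have hb'' := hrange _ hb''
        simp only [hf] at h2 h2'
        simp only at h ha hb' ha' hb''
        have g : ((p:ℤ) - q) * (p + q) = m := by rw [← h2]; ring
        have g' : ((p':ℤ) - q') * (p' + q') = m := by rw [← h2']; ring
        have hs : (0:ℤ) < p + q := by omega
        have hs' : (0:ℤ) < p' + q' := by omega
        have hdne : (p:ℤ) - q ≠ 0 := by
          rintro h0; rw [h0, zero_mul] at g; exact hm0 g.symm
        have hd : (p:ℤ) - q = p' - q' := by
          rcases Int.natAbs_eq_natAbs_iff.mp h with h | h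
          · exact h
          · exfalso
            rw [h] at g hdne
            have : ((p':ℤ) - q') * ((p + q) + (p' + q')) = 0 := by linarith
            rcases mul_eq_zero.mp this with h | h
            · exact hdne (by rw [h]; rfl)
            · omega
        have hsum : (p:ℤ) + q = p' + q' := by
          rw [← g', ← hd] at g
          exact mul_left_cancel₀ hdne g
        rw [Prod.mk.injEq]
        constructor <;> omega
    exact_mod_cast this
  have hoff : (A.offDiag.card : ℝ) ≤ D * B.card := by
    rw [Finset.card_eq_sum_card_image f A.offDiag]
    push_cast
    refine (Finset.sum_le_sum hfib).trans ?_
    rw [Finset.sum_const, nsmul_eq_mul, mul_comm]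
  have hD0 : 0 ≤ D := le_trans (by positivity) (hD 1 (by norm_num) (by nlinarith))
  have hoc : (A.card : ℝ)^2 = A.card + A.offDiag.card := by
    have h1 := Finset.offDiag_card A
    have h2 : A.card ≤ A.card * A.card := Nat.le_mul_self _
    have h3 : A.card * A.card = A.card + A.offDiag.card := by omega
    rw [sq]
    exact_mod_cast h3
  rw [hoc]
  have := mul_le_mul_of_nonneg_left hBc hD0
  linarith

lemma mem_SQ {Q : ℕ} {x : ℚ} (hx : x ∈ SQ Q) : ∃ q a : ℕ, Q < q ∧ q ≤ 2 * Q ∧ 1 ≤ a ∧ a < q^2 ∧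
    Nat.gcd a q = 1 ∧ x = (a:ℚ) / (q:ℚ)^2 := by
  simp [SQ] at hx
  obtain ⟨q, ⟨h1, h2⟩, a, ⟨⟨h3, h4⟩, h5⟩, rfl⟩ := hx
  exact ⟨q, a, h1, h2, h3, h4, h5, rfl⟩

/-- Reduction to counting moduli. -/
lemma count_T (Q N : ℕ) (hQ : 0 < Q) (hN : 0 < N) (x : ℚ) (hx : x ∈ SQ Q) :
    ∃ A : Finset ℕ, A ⊆ Finset.Ioc Q (2*Q) ∧
      (∀ q ∈ A, ∃ c : ℤ, |(x:ℝ) * (q:ℝ)^2 - c| ≤ 2 * (Q:ℝ)^2 / N) ∧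
      ((((SQ Q).filter fun x' => dist01 ((x : ℝ) - (x' : ℝ)) < 1/(2*N)).card : ℕ) : ℝ) ≤
        3 * (2 * (2 * (Q:ℝ)^2 / N) + 1) * A.card := by
  set T := (SQ Q).filter fun x' => dist01 ((x : ℝ) - (x' : ℝ)) < 1/(2*N) with hT
  have hN' : (0:ℝ) < N := by exact_mod_cast hN
  have hbd : ∀ y ∈ SQ Q, (0:ℝ) < y ∧ (y:ℝ) < 1 := by
    intro y hy
    obtain ⟨q, a, h1, h2, h3, h4, h5, rfl⟩ := mem_SQ hy
    have hq : (0:ℝ) < q := by exact_mod_cast (by omega : 0 < q)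
    have ha : (0:ℝ) < a := by exact_mod_cast (by omega : 0 < a)
    have h4' : (a:ℝ) < (q:ℝ)^2 := by exact_mod_cast h4
    push_cast
    exact ⟨by positivity, by rw [div_lt_one (by positivity)]; exact h4'⟩
  have hex : ∀ y ∈ T, ∃ q : ℕ, ∃ a : ℕ, ∃ k : ℤ, Q < q ∧ q ≤ 2 * Q ∧ y = (a:ℝ) / (q:ℝ)^2 ∧
      k ∈ Finset.Icc (-1:ℤ) 1 ∧ |((a:ℤ):ℝ) - ((x:ℝ) - k) * (q:ℝ)^2| ≤ 2 * (Q:ℝ)^2 / N := by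
    intro y hy
    obtain ⟨hy, hd⟩ := Finset.mem_filter.mp hy
    have hy' : ∃ z ∈ SQ Q, (z:ℝ) = y := by simpa using hy
    obtain ⟨y, hyS, rfl⟩ := hy'
    have hb1 := hbd x hx
    have hb2 := hbd y hyS
    obtain ⟨q, a, h1, h2, h3, h4, h5, rfl⟩ := mem_SQ hyS
    have hq : (0:ℝ) < q := by exact_mod_cast (by omega : 0 < q)
    have hq2 : (q:ℝ) ≤ 2 * Q := by exact_mod_cast h2
    refine ⟨q, a, round ((x:ℝ) - (((a:ℚ) / (q:ℚ)^2 : ℚ) : ℝ)), h1, h2, by push_cast; rfl, ?_, ?_⟩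
    · have h := abs_le.mp (abs_sub_round ((x:ℝ) - (((a:ℚ) / (q:ℚ)^2 : ℚ) : ℝ)))
      set k := round ((x:ℝ) - (((a:ℚ) / (q:ℚ)^2 : ℚ) : ℝ))
      have g1 : (k:ℝ) < 2 := by linarith
      have g2 : (-2:ℝ) < k := by linarith
      have g1 : k < 2 := by exact_mod_cast g1
      have g2 : -2 < k := by exact_mod_cast g2
      rw [Finset.mem_Icc]; omega
    · unfold dist01 at hd
      set k := round ((x:ℝ) - (((a:ℚ) / (q:ℚ)^2 : ℚ) : ℝ))
      have e1 : ((a:ℤ):ℝ) - ((x:ℝ) - k) * (q:ℝ)^2 =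
          -(((x:ℝ) - (((a:ℚ) / (q:ℚ)^2 : ℚ) : ℝ) - k) * (q:ℝ)^2) := by
        push_cast; field_simp; ring
      rw [e1, abs_neg, abs_mul, abs_of_pos (by positivity : (0:ℝ) < (q:ℝ)^2)]
      calc _ ≤ 1/(2*(N:ℝ)) * (2 * Q)^2 := by gcongr
        _ = _ := by field_simp
  choose! qf af kf h1 h2 h3 h4 h5 using hex
  refine ⟨T.image qf, ?_, ?_, ?_⟩
  · intro q hq
    obtain ⟨y, hy, rfl⟩ := Finset.mem_image.mp hq
    exact Finset.mem_Ioc.mpr ⟨h1 y hy, h2 y hy⟩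
  · intro q hq
    obtain ⟨y, hy, rfl⟩ := Finset.mem_image.mp hq
    refine ⟨af y + kf y * (qf y)^2, ?_⟩
    rw [abs_sub_comm]
    convert h5 y hy using 2
    push_cast; ring
  · have hcard : T.card = ∑ p ∈ (T.image qf) ×ˢ (Finset.Icc (-1:ℤ) 1),
        (T.filter fun y => (qf y, kf y) = p).card := by
      apply Finset.card_eq_sum_card_fiberwise
      intro y hy
      simp only [Finset.coe_product, Set.mem_prod, Finset.mem_coe]
      exact ⟨Finset.mem_image_of_mem _ hy, h4 y hy⟩
    have hfib : ∀ p ∈ (T.image qf) ×ˢ (Finset.Icc (-1:ℤ) 1),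
        (((T.filter fun y => (qf y, kf y) = p).card : ℕ) : ℝ) ≤ 2 * (2 * (Q:ℝ)^2 / N) + 1 := by
      rintro ⟨q, k⟩ -
      set F := T.filter fun y => (qf y, kf y) = (q, k)
      have hF : ∀ y ∈ F, y ∈ T ∧ qf y = q ∧ kf y = k := by
        intro y hy
        obtain ⟨g1, g2⟩ := Finset.mem_filter.mp hy
        rw [Prod.mk.injEq] at g2
        exact ⟨g1, g2⟩
      have hinj : (F.image fun y => (af y : ℤ)).card = F.card := by
        apply Finset.card_image_of_injOn
        intro y hy y' hy' h
        obtain ⟨g1, g2, g3⟩ := hF y hy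
        obtain ⟨g1', g2', g3'⟩ := hF y' hy'
        have h : (af y : ℤ) = af y' := h
        have h : af y = af y' := by exact_mod_cast h
        rw [h3 y g1, h3 y' g1', g2, g2', h]
      rw [← hinj]
      refine card_int_le _ (((x:ℝ) - k) * (q:ℝ)^2) _ (by positivity) ?_
      intro a ha
      obtain ⟨y, hy, rfl⟩ := Finset.mem_image.mp ha
      obtain ⟨g1, g2, g3⟩ := hF y hy
      have := h5 y g1
      rw [g2, g3] at this
      exact this
    rw [hcard]
    push_cast
    refine (Finset.sum_le_sum hfib).trans ?_
    rw [Finset.sum_const, Finset.card_product, nsmul_eq_mul]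
    have h3 : (Finset.Icc (-1:ℤ) 1).card = 3 := by decide
    rw [h3]
    push_cast
    apply le_of_eq; ring

set_option maxHeartbeats 1000000 in
theorem stmt0 : ∀ ε : ℝ, ε > 0 → ∃ C : ℝ, C > 0 ∧ ∀ Q N : ℕ, 0 < Q → 0 < N →
    (MQN Q N : ℝ) ≤ C * ((Q:ℝ)^3 / (N:ℝ) + (Real.sqrt Q + (Q:ℝ)^2 / Real.sqrt N) * (N:ℝ)^ε) := by
  intro ε hε
  obtain ⟨C, hC1, hC⟩ := divisor_bound ε hε
  refine ⟨24 + 6 * (1 + 18 * C), by linarith, fun Q N hQ hN => ?_⟩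
  have hN' : (1:ℝ) ≤ N := by exact_mod_cast hN
  have hQ' : (1:ℝ) ≤ Q := by exact_mod_cast hQ
  have hNe : (1:ℝ) ≤ (N:ℝ)^ε := Real.one_le_rpow hN' hε.le
  have hsQ : (1:ℝ) ≤ Real.sqrt Q := Real.one_le_sqrt.mpr hQ'
  have hsN : (0:ℝ) < Real.sqrt N := Real.sqrt_pos.mpr (by linarith)
  set U : ℝ := (Q:ℝ)^2 / Real.sqrt N with hU
  have hU0 : 0 ≤ U := by positivity
  set V : ℝ := (Q:ℝ)^3 / (N:ℝ) with hV
  have hV0 : 0 ≤ V := by positivity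
  set W : ℝ := (N:ℝ)^ε with hW
  have hnat : MQN Q N ≤ ⌊(24 + 6 * (1 + 18 * C)) * (V + (Real.sqrt Q + U) * W)⌋₊ := by
    unfold MQN
    refine Finset.sup_le fun x hx => Nat.le_floor ?_
    obtain ⟨A, hA, hc, hT⟩ := count_T Q N hQ hN x hx
    refine hT.trans ?_
    have hpos : 0 ≤ (Real.sqrt Q + U) * W := by positivity
    rcases le_or_gt (N:ℝ) (4 * (Q:ℝ)^2) with hcase | hcase
    · have hAQ : (A.card : ℝ) ≤ Q := by
        have := Finset.card_le_card hA
        rw [Nat.card_Ioc] at this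
        exact_mod_cast (by omega : A.card ≤ Q)
      have h1 : 1 ≤ 4 * (Q:ℝ)^2 / N := by rw [le_div_iff₀ (by linarith)]; linarith
      calc _ ≤ 3 * (2 * (2 * (Q:ℝ)^2 / N) + 4 * (Q:ℝ)^2 / N) * Q := by gcongr
        _ = 24 * V := by rw [hV]; field_simp; ring
        _ ≤ _ := by nlinarith
    · obtain ⟨r, b, g1, g2, g3, g4, g5, rfl⟩ := mem_SQ hx
      have hr : (0:ℝ) < r := by exact_mod_cast (by omega : 0 < r)
      have hr2 : (r:ℝ) ≤ 2 * Q := by exact_mod_cast g2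
      have hcop : IsCoprime (b:ℤ) ((r:ℤ)^2) :=
        IsCoprime.pow_right (Nat.isCoprime_iff_coprime.mpr g5)
      have hkey := count_A Q hQ b ((r:ℤ)^2) (by
          have : Q^2 < r^2 := Nat.pow_lt_pow_left g1 (by norm_num)
          exact_mod_cast this) hcop
        (2 * (Q:ℝ)^2 / N) (by positivity) (C * W) (by
          intro n hn0 hn
          refine (hC n hn0).trans ?_
          have : (n:ℝ) ≤ N := by
            have : (n:ℝ) ≤ 4 * (Q:ℝ)^2 := by exact_mod_cast hn
            linarith
          exact mul_le_mul_of_nonneg_left (Real.rpow_le_rpow (by positivity) this hε.le)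
            (by linarith)) A hA (by
          intro q hq
          obtain ⟨c, h⟩ := hc q hq
          refine ⟨c, ?_⟩
          push_cast at h ⊢
          exact h)
      have hCW : 1 ≤ C * W := one_le_mul_of_one_le_of_one_le hC1 hNe
      have hUU : U^2 = (Q:ℝ)^4 / N := by
        rw [hU, div_pow, Real.sq_sqrt (by linarith)]; ring
      have hE : C * W * (9 * (2 * (2 * (2 * (Q:ℝ)^2 / N) * (((r:ℤ)^2 : ℤ) : ℝ)) + 1)) ≤
          (3 * (C * W) * (6 * U + 1))^2 := by
        have e1 : 2 * (2 * (2 * (Q:ℝ)^2 / N) * (((r:ℤ)^2 : ℤ) : ℝ)) ≤ 32 * U^2 := by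
          rw [hUU]; push_cast
          calc _ ≤ 2 * (2 * (2 * (Q:ℝ)^2 / N) * (2 * Q)^2) := by gcongr
            _ = _ := by ring
        have e2 : 2 * (2 * (2 * (Q:ℝ)^2 / N) * (((r:ℤ)^2 : ℤ) : ℝ)) + 1 ≤ (6 * U + 1)^2 := by
          nlinarith
        have e3 : C * W ≤ (C * W)^2 := by nlinarith
        calc _ ≤ (C * W)^2 * (9 * (6 * U + 1)^2) := by gcongr
          _ = _ := by ring
      have hG0 : 0 ≤ 3 * (C * W) * (6 * U + 1) := by positivity
      have hA1 : (A.card : ℝ) ≤ 1 + 3 * (C * W) * (6 * U + 1) := by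
        have hs : (A.card : ℝ)^2 ≤ A.card + (3 * (C * W) * (6 * U + 1))^2 := by linarith
        by_contra hcon
        push Not at hcon
        nlinarith
      have hA2 : (A.card : ℝ) ≤ (1 + 18 * C) * ((Real.sqrt Q + U) * W) := by
        have e1 : 0 ≤ U * W := by positivity
        have e2 : W ≤ Real.sqrt Q * W := by nlinarith
        have e3 : C * W ≤ C * (Real.sqrt Q * W) := mul_le_mul_of_nonneg_left e2 (by linarith)
        have e4 : 0 ≤ C * W := by linarith
        nlinarith
      have h1 : 2 * (2 * (Q:ℝ)^2 / N) ≤ 1 := by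
        have : 4 * (Q:ℝ)^2 / N ≤ 1 := by rw [div_le_one (by linarith)]; linarith
        calc _ = 4 * (Q:ℝ)^2 / N := by ring
          _ ≤ 1 := this
      calc _ ≤ 3 * (1 + 1) * ((1 + 18 * C) * ((Real.sqrt Q + U) * W)) := by gcongr
        _ ≤ _ := by
          have e1 : 0 ≤ (24 + 6 * (1 + 18 * C)) * V := by positivity
          nlinarith
  refine le_trans (Nat.cast_le.mpr hnat) (Nat.floor_le ?_)
  positivity
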